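/- arXiv:2604.02295 — 2 statements merged into one kernel-verified Lean document; each statement's English description precedes it below -/
import Mathlib

section
/- Fix B ∈ (0,1). There exists α_low(B) > 0 (in fact one may take α_low(B) = e/(2−B)) such that for every α with 0 < α < α_low(B), there exists a threshold A(α,B) > 0 such that for all α_f > A(α,B), max_{t₁∈[0,1]} F_OS(t₁) > max_{(t₁,t₂)∈[0,1]²} F_TS(t₁,t₂). (Equivalently, in the small-α regime the two-sided matching rate strictly exceeds the one-sided matching rate for all sufficiently large α_f.) -/
open Set

/-- `M = 2α + (α_f − α)B`, the rate in the one-sided objective. -/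
noncomputable def Mos (B α αf : ℝ) : ℝ := 2*α + (αf - α)*B

/-- The one-sided objective `F_OS`. -/
noncomputable def FOS (B α αf t₁ : ℝ) : ℝ :=
  (1 - B) * Real.exp (-(2*α * Real.exp (-(Mos B α αf * t₁))))
  + B * Real.exp (-((α + αf) * Real.exp (-(Mos B α αf * t₁))))
  + Real.exp (-(Mos B α αf * t₁)) * (1 + Mos B α αf * t₁) - 1

/-- `M₁ = (2 − B/2)α + (B/2)α_f`. -/
noncomputable def M1 (B α αf : ℝ) : ℝ := (2 - B/2)*α + (B/2)*αf

/-- `M₂ = (1 − B/2)α + (1 + B/2)α_f`. -/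
noncomputable def M2 (B α αf : ℝ) : ℝ := (1 - B/2)*α + (1 + B/2)*αf

/-- The two-sided objective `F_TS`. -/
noncomputable def FTS (B α αf t₁ t₂ : ℝ) : ℝ :=
  (1 - B/2) * Real.exp (-(2*α*(1 - B/2) * Real.exp (-(M1 B α αf * t₁)))
      - (α + αf)*(B/2) * Real.exp (-(M2 B α αf * t₂)))
  + (B/2) * Real.exp (-((α + αf)*(1 - B/2) * Real.exp (-(M1 B α αf * t₁)))
      - αf*B * Real.exp (-(M2 B α αf * t₂)))
  + (1 - B/2) * Real.exp (-(M1 B α αf * t₁)) * (1 + M1 B α αf * t₁)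
  + (B/2) * Real.exp (-(M2 B α αf * t₂)) * (1 + M2 B α αf * t₂) - 1

/-- `max_{t₁ ∈ [0,1]} F_OS(t₁)` (the max is attained, so it equals the `sSup`). -/
noncomputable def maxOS (B α αf : ℝ) : ℝ := sSup (FOS B α αf '' Icc 0 1)

/-- `max_{(t₁,t₂) ∈ [0,1]²} F_TS(t₁,t₂)` (the max is attained, so it equals the `sSup`). -/
noncomputable def maxTS (B α αf : ℝ) : ℝ :=
  sSup ((fun p : ℝ × ℝ => FTS B α αf p.1 p.2) '' (Icc 0 1 ×ˢ Icc 0 1))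

lemma exp_neg_le_quad {k : ℝ} (hk : 0 ≤ k) : Real.exp (-k) ≤ 1 - k + k^2/2 := by
  have h := Real.quadratic_le_exp_of_nonneg hk
  rw [Real.exp_neg]
  have hp : 0 < Real.exp k := Real.exp_pos k
  rw [inv_le_iff_one_le_mul₀ hp]
  have h0 : 0 ≤ 1 - k + k^2/2 := by nlinarith [sq_nonneg (k-1)]
  have := mul_le_mul_of_nonneg_left h h0
  nlinarith [sq_nonneg (k^2)]

lemma h_le_one (p : ℝ) : Real.exp (-p) * (1 + p) ≤ 1 := by
  rw [Real.exp_neg, inv_mul_le_iff₀ (Real.exp_pos p)]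
  linarith [Real.add_one_le_exp p]

lemma h_le_small {p s : ℝ} (hs : 0 < s) (h : Real.exp (-p) < s^2) :
    Real.exp (-p) * (1 + p) ≤ 2 * s := by
  have e : Real.exp (-p) = Real.exp (-p/2) * Real.exp (-p/2) := by
    rw [← Real.exp_add]; ring_nf
  have hq := Real.exp_pos (-p/2)
  have h1 : Real.exp (-p/2) < s := by
    rw [e] at h; nlinarith
  have h2 : Real.exp (-p/2) * (1 + p/2) ≤ 1 := by
    have := h_le_one (p/2)
    rwa [← neg_div] at this
  rw [e]
  nlinarith [mul_le_mul_of_nonneg_left h2 hq.le, mul_pos hq hq]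

lemma main_term {α c p : ℝ} (hα : 0 < α) (hα1 : α < 1/2) (hc : 0 < c) (hc1 : c ≤ 1)
    (hp : 0 ≤ p) :
    Real.exp (-(2*α*c*Real.exp (-p))) + Real.exp (-p) * (1+p)
      ≤ 2 - 2*α*c + 4*α^2*c^2 := by
  have hy := Real.exp_pos (-p)
  have hy1 : Real.exp (-p) ≤ 1 := Real.exp_le_one_iff.2 (by linarith)
  set y := Real.exp (-p) with hyd
  have hac : 0 < α * c := mul_pos hα hc
  have hac1 : α * c < 1 := by nlinarith
  have h1 := exp_neg_le_quad (k := 2*α*c*y) (by positivity)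
  set k := 2*α*c - 2*α^2*c^2 with hk
  have hk0 : 0 ≤ k := by rw [hk]; nlinarith
  have hk1 : k ≤ 2*α*c := by rw [hk]; nlinarith [sq_nonneg (α*c)]
  have h2 := exp_neg_le_quad hk0
  have h3 : y * (1 + p - k) ≤ Real.exp (-k) := by
    have := Real.add_one_le_exp (p-k)
    have e : Real.exp (-k) = y * Real.exp (p-k) := by
      rw [hyd, ← Real.exp_add]; ring_nf
    rw [e]
    exact mul_le_mul_of_nonneg_left (by linarith) hy.le
  have h4 : k^2 ≤ (2*α*c)^2 := pow_le_pow_left₀ hk0 hk1 2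
  have h5 : (α*c)^2 * y^2 ≤ (α*c)^2 * y :=
    mul_le_mul_of_nonneg_left (by nlinarith) (sq_nonneg _)
  have h6 : y * k = 2*α*c*y - 2*((α*c)^2*y) := by rw [hk]; ring
  nlinarith

lemma ts_bound {B α f s p q : ℝ} (hB : 0 < B) (hB1 : B < 1) (hα : 0 < α) (hα1 : α < B^2/16)
    (hs : 0 < s) (hs1 : 4 * s ≤ (1-B)*(1-2*α)) (hs2 : 4 * s ≤ α*B^2/4) (hf : 2/(B*s^3) < f)
    (hp : 0 ≤ p) :
    (1 - B/2) * Real.exp (-(2*α*(1 - B/2) * Real.exp (-p)) - (α + f)*(B/2) * Real.exp (-q))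
  + (B/2) * Real.exp (-((α + f)*(1 - B/2) * Real.exp (-p)) - f*B * Real.exp (-q))
  + (1 - B/2) * Real.exp (-p) * (1 + p)
  + (B/2) * Real.exp (-q) * (1 + q) - 1 ≤ (1-B)*(1-2*α) := by
  have hf0 : 0 < f := lt_trans (by positivity) hf
  have hE : Real.exp (-(f*s^2*(B/2))) ≤ s := by
    rw [Real.exp_neg, inv_le_iff_one_le_mul₀ (Real.exp_pos _)]
    have h1 := Real.add_one_le_exp (f*s^2*(B/2))
    have h2 : 2 < f * (B*s^3) := by rwa [div_lt_iff₀ (by positivity)] at hf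
    nlinarith [mul_le_mul_of_nonneg_left h1 hs.le]
  have hy := Real.exp_pos (-p)
  have hz := Real.exp_pos (-q)
  have hhp := h_le_one p
  have hhq := h_le_one q
  have hc : 0 < 1 - B/2 := by linarith
  by_cases hzc : s^2 ≤ Real.exp (-q)
  · have hfz : f*s^2*(B/2) ≤ f * Real.exp (-q) * (B/2) := by gcongr
    have hX : 0 ≤ 2*α*(1 - B/2) * Real.exp (-p) := by positivity
    have hX2 : 0 ≤ (α + f)*(1 - B/2) * Real.exp (-p) := by positivity
    have haz : 0 ≤ α * Real.exp (-q) * (B/2) := by positivity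
    have hfz2 : 0 ≤ f * Real.exp (-q) * (B/2) := by positivity
    have t1 : Real.exp (-(2*α*(1 - B/2) * Real.exp (-p)) - (α + f)*(B/2) * Real.exp (-q)) ≤ s :=
      le_trans (Real.exp_le_exp.2 (by linarith)) hE
    have t2 : Real.exp (-((α + f)*(1 - B/2) * Real.exp (-p)) - f*B * Real.exp (-q)) ≤ s :=
      le_trans (Real.exp_le_exp.2 (by linarith)) hE
    nlinarith [mul_le_mul_of_nonneg_left t1 hc.le, mul_le_mul_of_nonneg_left hhp hc.le]
  · have hqs := h_le_small hs (not_le.1 hzc)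
    have haz : 0 ≤ (α+f) * (B/2) * Real.exp (-q) := by positivity
    have hfz : 0 ≤ f * B * Real.exp (-q) := by positivity
    by_cases hyc : s^2 ≤ Real.exp (-p)
    · have t1 : Real.exp (-(2*α*(1 - B/2) * Real.exp (-p)) - (α + f)*(B/2) * Real.exp (-q))
          ≤ Real.exp (-(2*α*(1 - B/2) * Real.exp (-p))) := Real.exp_le_exp.2 (by linarith)
      have hfy : f*s^2*(B/2) ≤ (α+f)*(1-B/2)*Real.exp (-p) := by
        calc f*s^2*(B/2) = f*(B/2)*s^2 := by ring
          _ ≤ (α+f)*(1-B/2)*Real.exp (-p) := by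
            gcongr <;> linarith
      have t2 : Real.exp (-((α + f)*(1 - B/2) * Real.exp (-p)) - f*B * Real.exp (-q)) ≤ s :=
        le_trans (Real.exp_le_exp.2 (by linarith)) hE
      have hm := main_term (c := 1 - B/2) hα (by nlinarith) hc (by linarith) hp
      have hm2 := mul_le_mul_of_nonneg_left hm hc.le
      have hm3 := mul_le_mul_of_nonneg_left t1 hc.le
      have hc3 : (1-B/2)^3 ≤ 1 := pow_le_one₀ hc.le (by linarith)
      have hc4 : α^2 * (1-B/2)^3 ≤ α^2 * 1 := mul_le_mul_of_nonneg_left hc3 (sq_nonneg _)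
      have ha : α * α ≤ α * (B^2/16) := mul_le_mul_of_nonneg_left hα1.le hα.le
      have t3 : B * s ≤ 1 * s := by gcongr
      have t4 := mul_le_mul_of_nonneg_left t2 (by linarith : 0 ≤ B/2)
      have t5 := mul_le_mul_of_nonneg_left hqs (by linarith : 0 ≤ B/2)
      linarith
    · have hps := h_le_small hs (not_le.1 hyc)
      have hX : 0 ≤ 2*α*(1 - B/2) * Real.exp (-p) := by positivity
      have hX2 : 0 ≤ (α + f)*(1 - B/2) * Real.exp (-p) := by positivity
      have t1 : Real.exp (-(2*α*(1 - B/2) * Real.exp (-p)) - (α + f)*(B/2) * Real.exp (-q)) ≤ 1 :=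
        Real.exp_le_one_iff.2 (by linarith)
      have t2 : Real.exp (-((α + f)*(1 - B/2) * Real.exp (-p)) - f*B * Real.exp (-q)) ≤ 1 :=
        Real.exp_le_one_iff.2 (by linarith)
      have t4 := mul_le_mul_of_nonneg_left t2 (by linarith : 0 ≤ B/2)
      have t5 := mul_le_mul_of_nonneg_left hqs (by linarith : 0 ≤ B/2)
      have t6 := mul_le_mul_of_nonneg_left t1 hc.le
      have t7 := mul_le_mul_of_nonneg_left hps hc.le
      linarith

/-- Two-sided dominance in the small-`α` regime: for any `B ∈ (0,1)` there exists
`α_low(B) > 0` such that for every `0 < α < α_low(B)` there is a threshold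
`A(α,B) > 0` with `max F_OS > max F_TS` for all `α_f > A(α,B)`. -/
theorem two_sided_dominance_small_alpha (B : ℝ) (hB : B ∈ Ioo (0:ℝ) 1) :
    ∃ αlow : ℝ, 0 < αlow ∧
      ∀ α : ℝ, 0 < α → α < αlow →
        ∃ A : ℝ, 0 < A ∧ ∀ αf : ℝ, A < αf → maxTS B α αf < maxOS B α αf := by
  obtain ⟨hB0, hB1⟩ := hB
  refine ⟨B^2/16, by positivity, fun α hα hα1 => ?_⟩
  have hB2 : B^2 < 1 := by nlinarith
  have hT : 0 < (1-B)*(1-2*α) := mul_pos (by linarith) (by linarith)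
  have hD : 0 < α*B^2/4 := by positivity
  obtain ⟨s, hs, hs1, hs2⟩ : ∃ s : ℝ, 0 < s ∧ 4*s ≤ (1-B)*(1-2*α) ∧ 4*s ≤ α*B^2/4 :=
    ⟨min ((1-B)*(1-2*α)) (α*B^2/4) / 4, by positivity,
      by linarith [min_le_left ((1-B)*(1-2*α)) (α*B^2/4)],
      by linarith [min_le_right ((1-B)*(1-2*α)) (α*B^2/4)]⟩
  refine ⟨2/(B*s^3), by positivity, fun f hf => ?_⟩
  have hf0 : 0 < f := lt_trans (by positivity) hf
  have h1 : maxTS B α f ≤ (1-B)*(1-2*α) := by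
    apply csSup_le
    · exact ⟨_, (0, 0), by simp, rfl⟩
    · rintro _ ⟨⟨t₁, t₂⟩, ⟨ht₁, ht₂⟩, rfl⟩
      have hM : 0 ≤ M1 B α f := by
        unfold M1
        have : 0 ≤ (2 - B/2) := by linarith
        positivity
      exact ts_bound hB0 hB1 hα hα1 hs hs1 hs2 hf (mul_nonneg hM ht₁.1)
  have h2 : FOS B α f 0 ≤ maxOS B α f := by
    apply le_csSup
    · apply (isCompact_Icc.image _).bddAbove
      unfold FOS
      fun_prop
    · exact ⟨0, by simp, rfl⟩
  have h3 : (1-B)*(1-2*α) < FOS B α f 0 := by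
    unfold FOS
    simp only [mul_zero, neg_zero, Real.exp_zero, mul_one, add_zero]
    have e1 := mul_le_mul_of_nonneg_left (Real.add_one_le_exp (-(2*α))) (by linarith : 0 ≤ 1 - B)
    have e2 := mul_pos hB0 (Real.exp_pos (-(α+f)))
    linarith
  linarith
end

section
/- For all real numbers Y ≥ 0, Z > 0, and u with 0 < u ≤ Z, the following inequality holds: Y·e^{−u} + u·(1 − ln(u/Z)) − Z ≤ e^{−Z}·(e^{Y} − 1). -/
lemma aux_conv (x u : ℝ) (hu : 0 < u) (hx : u ≤ x) :
    0 ≤ Real.exp (-x) - Real.exp (-u) + 1 - u / x := by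
  have hx0 : 0 < x := lt_of_lt_of_le hu hx
  have h1 : u / x ≤ 1 := (div_le_one hx0).2 hx
  have h0 : 0 < u / x := div_pos hu hx0
  have h := convexOn_exp.2 (Set.mem_univ (-x)) (Set.mem_univ (0:ℝ)) h0.le
    (sub_nonneg.2 h1) (by ring)
  have e : u / x * (-x) = -u := by field_simp
  simp only [smul_eq_mul, mul_zero, add_zero, Real.exp_zero, mul_one, e] at h
  have := Real.exp_pos (-x)
  nlinarith

lemma aux_mono (Z u : ℝ) (hu : 0 < u) (huZ : u ≤ Z) :
    0 ≤ Real.exp (-u) - Real.exp (-Z) - (Z - u) * Real.exp (-u) + Z - u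
      + u * (Real.log u - Real.log Z) := by
  have hd : ∀ x : ℝ, 0 < x → HasDerivAt (fun x : ℝ => Real.exp (-u) - Real.exp (-x)
      - (x - u) * Real.exp (-u) + x - u + u * (Real.log u - Real.log x))
      (Real.exp (-x) - Real.exp (-u) + 1 - u / x) x := by
    intro x hx
    have h1 := (hasDerivAt_neg x).exp
    have h2 := ((hasDerivAt_id x).sub_const u).mul_const (Real.exp (-u))
    have h3 := ((Real.hasDerivAt_log hx.ne').const_sub (Real.log u)).const_mul u
    have h4 := ((((h1.const_sub (Real.exp (-u))).sub h2).add (hasDerivAt_id x)).sub_const u).add h3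
    refine h4.congr_deriv ?_
    ring
  have hm := monotoneOn_of_hasDerivWithinAt_nonneg (convex_Ici u)
    (fun x hx => (hd x (lt_of_lt_of_le hu hx)).continuousAt.continuousWithinAt)
    (fun x hx => (hd x (lt_of_lt_of_le hu (interior_subset hx))).hasDerivWithinAt)
    (fun x hx => aux_conv x u hu (interior_subset hx))
  have := hm (Set.mem_Ici.2 le_rfl) (Set.mem_Ici.2 huZ) huZ
  simpa using this

/-- Auxiliary inequality: for `Y ≥ 0`, `Z > 0`, `0 < u ≤ Z`,
`Y·e^{−u} + u(1 − ln(u/Z)) − Z ≤ e^{−Z}(e^{Y} − 1)`. -/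
theorem aux_ineq (Y Z u : ℝ) (hY : 0 ≤ Y) (hZ : 0 < Z) (hu : 0 < u) (huZ : u ≤ Z) :
    Y * Real.exp (-u) + u * (1 - Real.log (u / Z)) - Z ≤
      Real.exp (-Z) * (Real.exp Y - 1) := by
  have h := aux_mono Z u hu huZ
  have h1 : Real.exp (-Z) * Real.exp Y = Real.exp (-u) * Real.exp (Y - Z + u) := by
    rw [← Real.exp_add, ← Real.exp_add]; congr 1; ring
  have h2 := mul_le_mul_of_nonneg_left (Real.add_one_le_exp (Y - Z + u)) (Real.exp_pos (-u)).le
  rw [Real.log_div hu.ne' hZ.ne', mul_sub (Real.exp (-Z)), h1]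
  linarith
end
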